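/- arXiv:2408.16240 — 8 statements merged into one kernel-verified Lean document; each statement's English description precedes it below -/
import Mathlib

section
/- Let N be a submodule of an R-module M and let n ≥ 1. Then the image of ⟨E_n(N)⟩ under the canonical projection π : M → M/⟨E_{n-1}(N)⟩ equals ⟨E_{M/⟨E_{n-1}(N)⟩}(0̄)⟩, the submodule of M/⟨E_{n-1}(N)⟩ generated by the envelope of its zero submodule; i.e., ⟨E_n(N)⟩/⟨E_{n-1}(N)⟩ = ⟨E_{M/⟨E_{n-1}(N)⟩}(0̄)⟩. -/
open Submodule

universe u v

/-- The envelope `E_M(N)` of a submodule `N` of `M`: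
the set of elements `a • m` with `a ^ k • m ∈ N` for some positive integer `k`. -/
def envSet {R : Type u} [CommRing R] {M : Type v} [AddCommGroup M] [Module R M]
    (N : Submodule R M) : Set M :=
  {x | ∃ (a : R) (m : M) (k : ℕ), 0 < k ∧ a ^ k • m ∈ N ∧ x = a • m}

/-- The submodule `⟨E_M(N)⟩` generated by the envelope of `N`. -/
def envSub {R : Type u} [CommRing R] {M : Type v} [AddCommGroup M] [Module R M]
    (N : Submodule R M) : Submodule R M :=
  Submodule.span R (envSet N)

/-- `chainSub N n = ⟨E_n(N)⟩`: the ascending chain with `⟨E_0(N)⟩ = N` and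
`⟨E_{n+1}(N)⟩ = ⟨E_M(⟨E_n(N)⟩)⟩`. -/
def chainSub {R : Type u} [CommRing R] {M : Type v} [AddCommGroup M] [Module R M]
    (N : Submodule R M) : ℕ → Submodule R M
  | 0 => N
  | n + 1 => envSub (chainSub N n)

/-- A proper submodule `K` is semiprime if `a ^ 2 • m ∈ K` implies `a • m ∈ K`. -/
def IsSemiprimeSub {R : Type u} [CommRing R] {M : Type v} [AddCommGroup M] [Module R M]
    (K : Submodule R M) : Prop :=
  K ≠ ⊤ ∧ ∀ (a : R) (m : M), a ^ 2 • m ∈ K → a • m ∈ K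

/-- The semiprime radical `S(N)`: the intersection of all semiprime submodules containing `N`. -/
def spRadical {R : Type u} [CommRing R] {M : Type v} [AddCommGroup M] [Module R M]
    (N : Submodule R M) : Submodule R M :=
  sInf {K | IsSemiprimeSub K ∧ N ≤ K}

/-- A proper submodule `P` is prime if `a • m ∈ P` implies `m ∈ P` or `a • M ⊆ P`. -/
def IsPrimeSub {R : Type u} [CommRing R] {M : Type v} [AddCommGroup M] [Module R M]
    (P : Submodule R M) : Prop :=
  P ≠ ⊤ ∧ ∀ (a : R) (m : M), a • m ∈ P → m ∈ P ∨ ∀ x : M, a • x ∈ P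

/-- The prime radical `β(N)`: the intersection of all prime submodules containing `N`. -/
def primeRadical {R : Type u} [CommRing R] {M : Type v} [AddCommGroup M] [Module R M]
    (N : Submodule R M) : Submodule R M :=
  sInf {P | IsPrimeSub P ∧ N ≤ P}

/-- `Γ_a(M) = {m : a ^ k • m = 0 for some positive integer k}`. -/
def Gamma {R : Type u} [CommRing R] {M : Type v} [AddCommGroup M] [Module R M]
    (a : R) : Submodule R M where
  carrier := {m | ∃ k : ℕ, 0 < k ∧ a ^ k • m = 0}
  zero_mem' := ⟨1, one_pos, smul_zero _⟩
  add_mem' := by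
    rintro x y ⟨k, hk, hx⟩ ⟨l, hl, hy⟩
    refine ⟨k + l, by omega, ?_⟩
    have h1 : a ^ (k + l) • x = 0 := by rw [pow_add, mul_comm, mul_smul, hx, smul_zero]
    have h2 : a ^ (k + l) • y = 0 := by rw [pow_add, mul_smul, hy, smul_zero]
    rw [smul_add, h1, h2, add_zero]
  smul_mem' := by
    rintro c x ⟨k, hk, hx⟩
    exact ⟨k, hk, by rw [smul_comm, hx, smul_zero]⟩

/-- `aΓ_a(M)`: the image of `Γ_a(M)` under multiplication by `a`. -/
def aGamma {R : Type u} [CommRing R] {M : Type v} [AddCommGroup M] [Module R M]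
    (a : R) : Submodule R M :=
  (Gamma (M := M) a).map (LinearMap.lsmul R M a)

/-- An element `m` of an `R`-module is nilpotent if `m = Σ_{i=1}^r a_i • m_i` with
`a_i ^ k • m_i = 0` for all `i`, for some positive integers `r`, `k`. -/
def IsNilpotentElem (R : Type u) [CommRing R] {M : Type v} [AddCommGroup M] [Module R M]
    (m : M) : Prop :=
  ∃ (r : ℕ) (a : Fin r → R) (x : Fin r → M) (k : ℕ),
    0 < r ∧ 0 < k ∧ m = ∑ i, a i • x i ∧ ∀ i, (a i) ^ k • x i = 0

/-- A reduced module: `a ^ k • m = 0` (for some positive `k`) implies `a • m = 0`,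
i.e. `E_M(0) = 0`. -/
def IsReducedModule (R : Type u) [CommRing R] (M : Type v) [AddCommGroup M] [Module R M] : Prop :=
  ∀ (a : R) (m : M) (k : ℕ), 0 < k → a ^ k • m = 0 → a • m = 0

/-- The image of the envelope of `K` in `M ⧸ K` is the envelope of the zero submodule. -/
theorem image_mkQ_envSet {R : Type u} [CommRing R] {M : Type v} [AddCommGroup M] [Module R M]
    (K : Submodule R M) : K.mkQ '' envSet K = envSet (⊥ : Submodule R (M ⧸ K)) := by
  ext y
  constructor
  · rintro ⟨_, ⟨a, m, k, hk, hm, rfl⟩, rfl⟩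
    refine ⟨a, K.mkQ m, k, hk, ?_, map_smul _ _ _⟩
    rwa [Submodule.mem_bot, ← map_smul, Submodule.mkQ_apply, Submodule.Quotient.mk_eq_zero]
  · rintro ⟨a, y, k, hk, hy, rfl⟩
    obtain ⟨m, rfl⟩ := K.mkQ_surjective y
    refine ⟨a • m, ⟨a, m, k, hk, ?_, rfl⟩, map_smul _ _ _⟩
    rwa [Submodule.mem_bot, ← map_smul, Submodule.mkQ_apply,
      Submodule.Quotient.mk_eq_zero] at hy

/-- For `n ≥ 1`, the image of `⟨E_n(N)⟩` in `M/⟨E_{n-1}(N)⟩` is the submodule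
generated by the envelope of the zero submodule of the quotient:
`⟨E_n(N)⟩/⟨E_{n-1}(N)⟩ = ⟨E_{M/⟨E_{n-1}(N)⟩}(0̄)⟩`. -/
theorem stmt1 {R : Type u} [CommRing R] {M : Type v} [AddCommGroup M] [Module R M]
    (N : Submodule R M) (n : ℕ) :
    Submodule.map (chainSub N n).mkQ (chainSub N (n + 1)) =
      envSub (⊥ : Submodule R (M ⧸ chainSub N n)) := by
  rw [chainSub, envSub, envSub, Submodule.map_span, image_mkQ_envSet]
end

section
/- Let N be a submodule of an R-module M. If ⟨E_M(N)⟩ is a semiprime submodule of M, then ⟨E_M(N)⟩ = S(N), i.e., it is the smallest semiprime submodule of M containing N. -/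
open Submodule

universe u v

theorem IsSemiprimeSub.smul_mem_of_pow_smul_mem {R : Type u} [CommRing R] {M : Type v}
    [AddCommGroup M] [Module R M] {K : Submodule R M} (hK : IsSemiprimeSub K) {a : R} {m : M}
    {k : ℕ} (hk : 0 < k) (h : a ^ k • m ∈ K) : a • m ∈ K := by
  induction k, hk using Nat.le_induction with
  | base => simpa using h
  | succ n hn ih =>
    obtain ⟨j, rfl⟩ := Nat.exists_eq_add_of_le' hn
    refine ih ?_
    rw [pow_succ', mul_smul]
    refine hK.2 a (a ^ j • m) ?_
    rwa [← mul_smul, ← pow_add, add_comm]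

theorem IsSemiprimeSub.envSub_le {R : Type u} [CommRing R] {M : Type v} [AddCommGroup M]
    [Module R M] {N K : Submodule R M} (hK : IsSemiprimeSub K) (hNK : N ≤ K) :
    envSub N ≤ K := by
  refine Submodule.span_le.2 ?_
  rintro _ ⟨a, m, k, hk, hm, rfl⟩
  exact hK.smul_mem_of_pow_smul_mem hk (hNK hm)

theorem le_envSub {R : Type u} [CommRing R] {M : Type v} [AddCommGroup M] [Module R M]
    (N : Submodule R M) : N ≤ envSub N :=
  fun x hx => Submodule.subset_span ⟨1, x, 1, one_pos, by simpa using hx, by simp⟩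

/-- If `⟨E_M(N)⟩` is a semiprime submodule of `M`, then it equals the
semiprime radical `S(N)`, the smallest semiprime submodule of `M` containing `N`. -/
theorem stmt3 {R : Type u} [CommRing R] {M : Type v} [AddCommGroup M] [Module R M]
    (N : Submodule R M) (h : IsSemiprimeSub (envSub N)) :
    envSub N = spRadical N :=
  le_antisymm (le_sInf fun _ hK => hK.1.envSub_le hK.2) (sInf_le ⟨h, le_envSub N⟩)
end

section
/- For any R-module M, the submodule ⟨E_M(0)⟩ is a nil submodule of M and contains every nil submodule of M; i.e., ⟨E_M(0)⟩ = Σ{N : N is a nil submodule of M} is the largest nil submodule of M. -/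
open Submodule

universe u v

section NilpotentElements

variable {R : Type u} [CommRing R] {M : Type v} [AddCommGroup M] [Module R M]

theorem IsNilpotentElem.smul_of_pow_smul_eq_zero {a : R} {x : M} {k : ℕ} (hk : 0 < k)
    (h : a ^ k • x = 0) : IsNilpotentElem R (a • x) :=
  ⟨1, fun _ => a, fun _ => x, k, one_pos, hk, by simp, fun _ => h⟩

theorem IsNilpotentElem.zero : IsNilpotentElem R (0 : M) := by
  simpa using IsNilpotentElem.smul_of_pow_smul_eq_zero (a := (0 : R)) (x := (0 : M)) one_pos
    (smul_zero _)

theorem IsNilpotentElem.add {m n : M} (hm : IsNilpotentElem R m) (hn : IsNilpotentElem R n) :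
    IsNilpotentElem R (m + n) := by
  obtain ⟨r, a, x, k, hr, hk, rfl, hx⟩ := hm
  obtain ⟨s, b, y, l, -, -, rfl, hy⟩ := hn
  refine ⟨r + s, Fin.append a b, Fin.append x y, k + l, by omega, by omega, ?_, fun i => ?_⟩
  · simp [Fin.sum_univ_add]
  · refine Fin.addCases (fun i => ?_) (fun i => ?_) i
    · rw [Fin.append_left, Fin.append_left, add_comm, pow_add, mul_smul, hx, smul_zero]
    · rw [Fin.append_right, Fin.append_right, pow_add, mul_smul, hy, smul_zero]

theorem IsNilpotentElem.smul (c : R) {m : M} (hm : IsNilpotentElem R m) :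
    IsNilpotentElem R (c • m) := by
  obtain ⟨r, a, x, k, hr, hk, rfl, hx⟩ := hm
  refine ⟨r, a, fun i => c • x i, k, hr, hk, ?_, fun i => ?_⟩
  · simp only [Finset.smul_sum, smul_comm c]
  · rw [smul_comm, hx, smul_zero]

theorem mem_envSub_bot_iff {m : M} :
    m ∈ envSub (⊥ : Submodule R M) ↔ IsNilpotentElem R m := by
  constructor
  · intro h
    refine Submodule.span_induction ?_ IsNilpotentElem.zero (fun _ _ _ _ => IsNilpotentElem.add)
      (fun c _ _ => IsNilpotentElem.smul c) h
    rintro _ ⟨a, x, k, hk, hx, rfl⟩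
    exact IsNilpotentElem.smul_of_pow_smul_eq_zero hk ((Submodule.mem_bot R).1 hx)
  · rintro ⟨r, a, x, k, -, hk, rfl, hx⟩
    exact Submodule.sum_mem _ fun i _ =>
      Submodule.subset_span ⟨a i, x i, k, hk, (Submodule.mem_bot R).2 (hx i), rfl⟩

end NilpotentElements

/-- `⟨E_M(0)⟩` is a nil submodule of `M` containing every nil submodule;
it equals the sum of all nil submodules of `M`, hence is the largest nil submodule. -/
theorem stmt10 {R : Type u} [CommRing R] {M : Type v} [AddCommGroup M] [Module R M] :
    (∀ m ∈ envSub (⊥ : Submodule R M), IsNilpotentElem R m) ∧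
    (∀ N : Submodule R M, (∀ m ∈ N, IsNilpotentElem R m) → N ≤ envSub (⊥ : Submodule R M)) ∧
    envSub (⊥ : Submodule R M) =
      sSup {N : Submodule R M | ∀ m ∈ N, IsNilpotentElem R m} := by
  have nil : ∀ m ∈ envSub (⊥ : Submodule R M), IsNilpotentElem R m :=
    fun _ => mem_envSub_bot_iff.1
  have largest : ∀ N : Submodule R M, (∀ m ∈ N, IsNilpotentElem R m) →
      N ≤ envSub (⊥ : Submodule R M) :=
    fun _ hN m hm => mem_envSub_bot_iff.2 (hN m hm)
  exact ⟨nil, largest, le_antisymm (le_sSup nil) (sSup_le largest)⟩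
end

section
/- Let R be a commutative ring with unity that satisfies the radical formula. Then the functor M ↦ ⟨E_M(0)⟩ is an idempotent radical: for every R-module M, ⟨E_M(⟨E_M(0)⟩)⟩ = ⟨E_M(0)⟩, and the submodule generated by the envelope of the zero submodule of the quotient module M/⟨E_M(0)⟩ is zero, i.e., ⟨E_{M/⟨E_M(0)⟩}(0̄)⟩ = 0̄. -/
open Submodule

universe u v

theorem primeRadical_primeRadical {R : Type u} [CommRing R] {M : Type v} [AddCommGroup M]
    [Module R M] (N : Submodule R M) : primeRadical (primeRadical N) = primeRadical N :=
  le_antisymm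
    (le_sInf fun _ hP => sInf_le ⟨hP.1, sInf_le hP⟩)
    (le_sInf fun _ hP => hP.2)

/-- If `N` is closed under taking envelopes, then the zero submodule of `M ⧸ N` has trivial
envelope. -/
theorem envSub_bot_quotient {R : Type u} [CommRing R] {M : Type v} [AddCommGroup M]
    [Module R M] {N : Submodule R M} (hN : envSub N ≤ N) :
    envSub (⊥ : Submodule R (M ⧸ N)) = ⊥ := by
  refine eq_bot_iff.2 (Submodule.span_le.2 ?_)
  rintro _ ⟨a, m, k, hk, hm, rfl⟩
  obtain ⟨m, rfl⟩ := N.mkQ_surjective m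
  rw [← map_smul, Submodule.mem_bot, Submodule.mkQ_apply, Submodule.Quotient.mk_eq_zero] at hm
  rw [← map_smul, SetLike.mem_coe, Submodule.mem_bot, Submodule.mkQ_apply,
    Submodule.Quotient.mk_eq_zero]
  exact hN (Submodule.subset_span ⟨a, m, k, hk, hm, rfl⟩)

/-- If `R` satisfies the radical formula, then `M ↦ ⟨E_M(0)⟩` is an
idempotent radical: `⟨E_M(⟨E_M(0)⟩)⟩ = ⟨E_M(0)⟩` and the submodule generated by the
envelope of zero in `M/⟨E_M(0)⟩` is zero. -/
theorem stmt13 {R : Type u} [CommRing R]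
    (hRF : ∀ (P : Type v) [AddCommGroup P] [Module R P] (N : Submodule R P),
      envSub N = primeRadical N) :
    ∀ (M : Type v) [AddCommGroup M] [Module R M],
      envSub (envSub (⊥ : Submodule R M)) = envSub (⊥ : Submodule R M) ∧
      envSub (⊥ : Submodule R (M ⧸ envSub (⊥ : Submodule R M))) = ⊥ := by
  intro M _ _
  have h : envSub (envSub (⊥ : Submodule R M)) = envSub (⊥ : Submodule R M) := by
    rw [hRF M ⊥, hRF M (primeRadical ⊥), primeRadical_primeRadical]
  exact ⟨h, envSub_bot_quotient h.le⟩
end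

section
/- Let R be a commutative ring with unity that satisfies the radical formula. If T is a nil R-module and F is a reduced R-module, then every R-module homomorphism T → F is the zero homomorphism. -/
open Submodule

universe u v

/-- If `R` satisfies the radical formula, `T` is a nil `R`-module and `F` is
a reduced `R`-module, then every `R`-module homomorphism `T → F` is zero. -/
theorem stmt14 {R : Type u} [CommRing R]
    (hRF : ∀ (P : Type v) [AddCommGroup P] [Module R P] (N : Submodule R P),
      envSub N = primeRadical N)
    (T F : Type v) [AddCommGroup T] [Module R T] [AddCommGroup F] [Module R F]
    (hT : ∀ m : T, IsNilpotentElem R m) (hF : IsReducedModule R F)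
    (γ : T →ₗ[R] F) : γ = 0 := by
  ext m
  obtain ⟨r, a, x, k, -, hk, rfl, h⟩ := hT m
  rw [map_sum, LinearMap.zero_apply]
  refine Finset.sum_eq_zero fun i _ => ?_
  rw [map_smul]
  exact hF (a i) (γ (x i)) k hk (by rw [← map_smul, h i, map_zero])
end

section
/- Let M be a Noetherian uniserial R-module. Then M satisfies the semiprime radical formula; in fact, for every submodule N of M the envelope E_M(N) is itself a submodule of M and E_M(N) = S(N), the semiprime radical of N. -/
open Submodule

universe u v

theorem envSet_subset_spRadical {R : Type u} [CommRing R] {M : Type v} [AddCommGroup M]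
    [Module R M] (N : Submodule R M) : envSet N ⊆ (spRadical N : Set M) := by
  rintro _ ⟨a, m, k, hk, h, rfl⟩
  exact Submodule.mem_sInf.2 fun K hK => hK.1.smul_mem_of_pow_smul_mem hk (hK.2 h)

/-- In a cyclic module, the semiprime radical is contained in the envelope. -/
theorem spRadical_subset_envSet_of_span_eq_top {R : Type u} [CommRing R] {M : Type v}
    [AddCommGroup M] [Module R M] {g : M} (hg : span R {g} = ⊤) (N : Submodule R M) :
    (spRadical N : Set M) ⊆ envSet N := by
  have hgen (x : M) : ∃ r : R, r • g = x := mem_span_singleton.1 (hg ▸ mem_top)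
  let I : Ideal R := N.comap (LinearMap.toSpanSingleton R M g)
  let K : Submodule R M := Submodule.map (LinearMap.toSpanSingleton R M g) I.radical
  have hK_env : (K : Set M) ⊆ envSet N := by
    rintro _ ⟨r, ⟨k, hk⟩, rfl⟩
    refine ⟨r, g, k + 1, k.succ_pos, ?_, rfl⟩
    rw [pow_succ', mul_smul]
    exact N.smul_mem r hk
  have hNK : N ≤ K := by
    intro x hx
    obtain ⟨r, rfl⟩ := hgen x
    exact ⟨r, I.le_radical hx, rfl⟩
  have hmem {r : R} (hr : r • g ∈ K) : r ∈ I.radical := by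
    obtain ⟨s, hs, hsr⟩ := hr
    have hdiff : r - s ∈ I := by
      change (r - s) • g ∈ N
      have hsg : s • g = r • g := hsr
      rw [sub_smul, hsg, sub_self]
      exact N.zero_mem
    simpa using add_mem (I.le_radical hdiff) hs
  by_cases htop : K = ⊤
  · exact fun x _ => hK_env (htop ▸ mem_top : x ∈ K)
  · refine fun x hx => hK_env (Submodule.mem_sInf.1 hx K ⟨⟨htop, fun a m h => ?_⟩, hNK⟩)
    obtain ⟨r, rfl⟩ := hgen m
    rw [smul_smul] at h
    refine ⟨a * r, I.radical_isRadical ⟨2, ?_⟩, mul_smul a r g⟩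
    rw [show (a * r) ^ 2 = r * (a ^ 2 * r) by ring]
    exact Ideal.mul_mem_left _ r (hmem h)

/-- A Noetherian uniserial module is cyclic. -/
theorem exists_span_singleton_eq_top_of_uniserial {R : Type u} [CommRing R] {M : Type v}
    [AddCommGroup M] [Module R M] [IsNoetherian R M]
    (hu : ∀ N K : Submodule R M, N ≤ K ∨ K ≤ N) : ∃ g : M, span R {g} = ⊤ := by
  obtain ⟨_, ⟨g, rfl⟩, hmax⟩ := set_has_maximal_iff_noetherian.2 ‹IsNoetherian R M›
    (Set.range fun x : M => span R {x}) (Set.range_nonempty _)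
  refine ⟨g, eq_top_iff.2 fun x _ => ?_⟩
  have hle : span R {x} ≤ span R {g} :=
    (hu (span R {x}) (span R {g})).elim id fun h =>
      not_lt_iff_le_imp_ge.1 (hmax _ ⟨x, rfl⟩) h
  exact hle (mem_span_singleton_self x)

/-- A Noetherian uniserial `R`-module `M` satisfies the semiprime radical
formula; in fact, for every submodule `N` the envelope `E_M(N)` is itself a submodule
and `E_M(N) = S(N)`. -/
theorem stmt16 {R : Type u} [CommRing R] {M : Type v} [AddCommGroup M] [Module R M]
    [IsNoetherian R M] (hu : ∀ N K : Submodule R M, N ≤ K ∨ K ≤ N) :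
    ∀ N : Submodule R M,
      envSub N = spRadical N ∧ envSet N = (spRadical N : Set M) := by
  obtain ⟨g, hg⟩ := exists_span_singleton_eq_top_of_uniserial hu
  intro N
  have henv : envSet N = (spRadical N : Set M) :=
    (envSet_subset_spRadical N).antisymm (spRadical_subset_envSet_of_span_eq_top hg N)
  exact ⟨by rw [envSub, henv, span_eq], henv⟩
end

section
/- Let R be a Noetherian uniserial commutative ring with unity (a Noetherian ring whose ideals are totally ordered by inclusion). Then there exists a ∈ R such that the nilradical 𝒩(R) = aΓ_a(R). -/
open Submodule

universe u v

/-- In a Noetherian ring with totally ordered ideals, every ideal is principal. -/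
theorem exists_eq_span_singleton_of_ideal_total {R : Type u} [CommRing R] [IsNoetherianRing R]
    (hu : ∀ I J : Ideal R, I ≤ J ∨ J ≤ I) (I : Ideal R) :
    ∃ a : R, I = Ideal.span {a} := by
  obtain ⟨J, ⟨a, ha, rfl⟩, hmax⟩ := set_has_maximal_iff_noetherian.mpr ‹IsNoetherianRing R›
    ((fun x : R => Ideal.span {x}) '' I) ⟨_, 0, I.zero_mem, rfl⟩
  refine ⟨a, le_antisymm (fun y hy => ?_) ((Ideal.span_singleton_le_iff_mem I).mpr ha)⟩
  rw [← Ideal.span_singleton_le_iff_mem]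
  rcases hu (Ideal.span {y}) (Ideal.span {a}) with h | h
  · exact h
  · by_contra hn
    exact hmax _ ⟨y, hy, rfl⟩ (lt_of_le_not_ge h hn)

/-- If `a` is nilpotent then `Γ_a(M)` is all of `M`. -/
theorem Gamma_eq_top_of_isNilpotent {R : Type u} [CommRing R] {M : Type v} [AddCommGroup M]
    [Module R M] {a : R} (ha : IsNilpotent a) : Gamma (M := M) a = ⊤ := by
  obtain ⟨k, hk⟩ := ha
  exact eq_top_iff.mpr fun m _ => ⟨k + 1, k.succ_pos, by rw [pow_succ, hk, zero_mul, zero_smul]⟩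

/-- For a Noetherian uniserial commutative ring `R`, there exists `a ∈ R`
with `𝒩(R) = aΓ_a(R)`. -/
theorem stmt18 (R : Type u) [CommRing R] [IsNoetherianRing R]
    (hu : ∀ I J : Ideal R, I ≤ J ∨ J ≤ I) :
    ∃ a : R, nilradical R = aGamma (M := R) a := by
  obtain ⟨a, ha⟩ := exists_eq_span_singleton_of_ideal_total hu (nilradical R)
  have hnil : IsNilpotent a := mem_nilradical.mp (ha ▸ Ideal.mem_span_singleton_self a)
  refine ⟨a, ha.trans ?_⟩
  ext x
  rw [aGamma, Gamma_eq_top_of_isNilpotent hnil, Ideal.mem_span_singleton']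
  simp [mul_comm a]
end

section
/- If the commutative ring R with unity satisfies the radical formula, then for every R-module M the prime radical β(M) (the intersection of all prime submodules of M) is a nil submodule of M; and if M is a Noetherian uniserial R-module, then the semiprime radical S(M) is a nil submodule of M. -/
open Submodule

universe u v

theorem isNilpotentElem_of_mem_envSub_bot {R : Type u} [CommRing R] {M : Type v}
    [AddCommGroup M] [Module R M] {m : M} (hm : m ∈ envSub (⊥ : Submodule R M)) :
    IsNilpotentElem R m := by
  induction hm using Submodule.span_induction with
  | mem x hx =>
    obtain ⟨a, y, k, hk, h, rfl⟩ := hx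
    exact ⟨1, fun _ => a, fun _ => y, k, one_pos, hk, by simp, fun _ => by simpa using h⟩
  | zero => exact ⟨1, 0, 0, 1, one_pos, one_pos, by simp, by simp⟩
  | add x y _ _ hx hy =>
    obtain ⟨r, a, u, k, hr, hk, rfl, h⟩ := hx
    obtain ⟨s, b, w, l, -, -, rfl, h'⟩ := hy
    refine ⟨r + s, Fin.append a b, Fin.append u w, k + l, by omega, by omega, ?_, ?_⟩
    · simp [Fin.sum_univ_add]
    · refine Fin.addCases (fun i => ?_) (fun i => ?_)
      · simp [pow_add, mul_comm (a i ^ k), mul_smul, h]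
      · simp [pow_add, mul_smul, h']
  | smul c x _ hx =>
    obtain ⟨r, a, u, k, hr, hk, rfl, h⟩ := hx
    refine ⟨r, a, fun i => c • u i, k, hr, hk, ?_, fun i => ?_⟩
    · simp only [Finset.smul_sum, smul_comm c]
    · rw [smul_comm, h, smul_zero]

theorem pow_smul_eq_pow_smul {R : Type u} [CommRing R] {M : Type v} [AddCommGroup M]
    [Module R M] {s t : R} {m : M} (h : s • m = t • m) (k : ℕ) : s ^ k • m = t ^ k • m := by
  induction k with
  | zero => simp
  | succ k ih => rw [pow_succ, mul_smul, h, smul_comm, ih, ← mul_smul, ← pow_succ']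

theorem mem_envSet_bot_of_mem_envSub {R : Type u} [CommRing R] {M : Type v} [AddCommGroup M]
    [Module R M] (hM : ∀ N K : Submodule R M, N ≤ K ∨ K ≤ N) {m : M}
    (hm : m ∈ envSub (⊥ : Submodule R M)) : m ∈ envSet (⊥ : Submodule R M) := by
  have smul_mem : ∀ (c : R) (x : M), x ∈ envSet (⊥ : Submodule R M) →
      c • x ∈ envSet (⊥ : Submodule R M) := by
    rintro c x ⟨a, y, k, hk, h, rfl⟩
    refine ⟨a, c • y, k, hk, ?_, smul_comm c a y⟩
    rw [smul_comm]
    exact Submodule.smul_mem _ c h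
  induction hm using Submodule.span_induction with
  | mem x hx => exact hx
  | zero => exact ⟨0, 0, 1, one_pos, by simp, by simp⟩
  | add x y _ _ hx hy =>
    rcases hM (span R {x}) (span R {y}) with h | h
    · obtain ⟨c, rfl⟩ := mem_span_singleton.1 (h (mem_span_singleton_self x))
      simpa only [add_smul, one_smul] using smul_mem (c + 1) y hy
    · obtain ⟨c, rfl⟩ := mem_span_singleton.1 (h (mem_span_singleton_self y))
      simpa only [add_smul, one_smul] using smul_mem (1 + c) x hx
  | smul c x _ hx => exact smul_mem c x hx

theorem smul_mem_envSub_bot_of_sq_smul_mem {R : Type u} [CommRing R] {M : Type v}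
    [AddCommGroup M] [Module R M] (hM : ∀ N K : Submodule R M, N ≤ K ∨ K ≤ N) {a : R} {m : M}
    (h : a ^ 2 • m ∈ envSub (⊥ : Submodule R M)) : a • m ∈ envSub (⊥ : Submodule R M) := by
  obtain ⟨b, y, k, hk, hb, hab⟩ := mem_envSet_bot_of_mem_envSub hM h
  rw [mem_bot] at hb
  apply subset_span
  rcases hM (span R {y}) (span R {m}) with h | h
  · obtain ⟨c, rfl⟩ := mem_span_singleton.1 (h (mem_span_singleton_self y))
    refine ⟨a, m, 2 * k, by omega, ?_, rfl⟩
    rw [smul_smul] at hab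
    rw [mem_bot, pow_mul, pow_smul_eq_pow_smul hab, mul_pow]
    obtain ⟨j, rfl⟩ := Nat.exists_eq_succ_of_ne_zero hk.ne'
    rw [pow_succ c, ← mul_assoc, mul_right_comm, mul_comm, mul_smul,
      mul_smul, hb, smul_zero]
  · obtain ⟨c, rfl⟩ := mem_span_singleton.1 (h (mem_span_singleton_self m))
    refine ⟨a * c, y, 2 * k, by omega, ?_, smul_smul a c y⟩
    rw [smul_smul] at hab
    rw [mem_bot, pow_mul, mul_pow, sq c, ← mul_assoc, mul_comm, mul_pow, mul_smul,
      pow_smul_eq_pow_smul hab, hb, smul_zero]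

theorem spRadical_bot_le_envSub {R : Type u} [CommRing R] {M : Type v} [AddCommGroup M]
    [Module R M] (hM : ∀ N K : Submodule R M, N ≤ K ∨ K ≤ N) :
    spRadical (⊥ : Submodule R M) ≤ envSub ⊥ := by
  by_cases h : envSub (⊥ : Submodule R M) = ⊤
  · exact h ▸ le_top
  · exact sInf_le ⟨⟨h, fun _ _ => smul_mem_envSub_bot_of_sq_smul_mem hM⟩, bot_le⟩

/-- If `R` satisfies the radical formula, then the prime radical `β(M)` of
every `R`-module `M` is a nil submodule; and for every Noetherian uniserial `R`-module `M`,
the semiprime radical `S(M)` is a nil submodule. -/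
theorem stmt19 {R : Type u} [CommRing R] :
    ((∀ (P : Type v) [AddCommGroup P] [Module R P] (N : Submodule R P),
        envSub N = primeRadical N) →
      ∀ (M : Type v) [AddCommGroup M] [Module R M],
        ∀ m ∈ primeRadical (⊥ : Submodule R M), IsNilpotentElem R m) ∧
    (∀ (M : Type v) [AddCommGroup M] [Module R M] [IsNoetherian R M],
      (∀ N K : Submodule R M, N ≤ K ∨ K ≤ N) →
      ∀ m ∈ spRadical (⊥ : Submodule R M), IsNilpotentElem R m) := by
  refine ⟨fun h M _ _ m hm => ?_, fun M _ _ _ hM m hm => ?_⟩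
  · exact isNilpotentElem_of_mem_envSub_bot (h M ⊥ ▸ hm)
  · exact isNilpotentElem_of_mem_envSub_bot (spRadical_bot_le_envSub hM hm)
end
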